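/- The pressure at the bed beneath the crest gives a lower bound on the wave height: the maximum surface elevation h = η(0) satisfies h > (P(0,-d) - P_∞)/g, where P_∞ = P_atm + g·d is the asymptotic value of the pressure at the bed, i.e. P(x,-d) → P_∞ as x → ∞. -/

import Mathlib

open Real Filter Set

/-- Partial derivative in the first (horizontal) variable. -/
noncomputable def pdx (f : ℝ → ℝ → ℝ) (x y : ℝ) : ℝ := deriv (fun t => f t y) x

/-- Partial derivative in the second (vertical) variable. -/
noncomputable def pdy (f : ℝ → ℝ → ℝ) (x y : ℝ) : ℝ := deriv (fun t => f x t) y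

theorem hasDerivAt_pdx {f : ℝ → ℝ → ℝ} (hf : Differentiable ℝ fun q : ℝ × ℝ => f q.1 q.2)
    (x y : ℝ) : HasDerivAt (fun t => f t y) (pdx f x y) x := by
  have h : Differentiable ℝ fun t : ℝ => f t y :=
    hf.comp (f := fun t : ℝ => (t, y)) (by fun_prop)
  exact (h x).hasDerivAt

theorem hasDerivAt_pdy {f : ℝ → ℝ → ℝ} (hf : Differentiable ℝ fun q : ℝ × ℝ => f q.1 q.2)
    (x y : ℝ) : HasDerivAt (fun t => f x t) (pdy f x y) y := by
  have h : Differentiable ℝ fun t : ℝ => f x t :=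
    hf.comp (f := fun t : ℝ => (x, t)) (by fun_prop)
  exact (h y).hasDerivAt

theorem fderiv_apply_eq_pdx_pdy {f : ℝ → ℝ → ℝ}
    (hf : Differentiable ℝ fun q : ℝ × ℝ => f q.1 q.2) (q : ℝ × ℝ) (s t : ℝ) :
    fderiv ℝ (fun q : ℝ × ℝ => f q.1 q.2) q (s, t) =
      s * pdx f q.1 q.2 + t * pdy f q.1 q.2 := by
  have h1 : HasDerivAt (fun t => f t q.2)
      (fderiv ℝ (fun q : ℝ × ℝ => f q.1 q.2) q (1, 0)) q.1 :=
    (hf q).hasFDerivAt.comp_hasDerivAt (f := fun t : ℝ => (t, q.2)) q.1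
      ((hasDerivAt_id q.1).prodMk (hasDerivAt_const _ _))
  have h2 : HasDerivAt (fun t => f q.1 t)
      (fderiv ℝ (fun q : ℝ × ℝ => f q.1 q.2) q (0, 1)) q.2 :=
    (hf q).hasFDerivAt.comp_hasDerivAt (f := fun t : ℝ => (q.1, t)) q.2
      ((hasDerivAt_const _ _).prodMk (hasDerivAt_id q.2))
  rw [pdx, pdy, h1.deriv, h2.deriv]
  have : ((s, t) : ℝ × ℝ) = s • (1, 0) + t • (0, 1) := by simp
  rw [this, map_add, map_smul, map_smul]
  rfl

/-- The Cauchy-Riemann equations for the complex velocity, multiplied by `-i`. -/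
theorem differentiableAt_complex_velocity {u v : ℝ → ℝ → ℝ}
    (hu : Differentiable ℝ fun q : ℝ × ℝ => u q.1 q.2)
    (hv : Differentiable ℝ fun q : ℝ × ℝ => v q.1 q.2) {z : ℂ}
    (hinc : pdx u z.re z.im + pdy v z.re z.im = 0)
    (hirr : pdy u z.re z.im - pdx v z.re z.im = 0) :
    DifferentiableAt ℂ (fun z : ℂ => -(v z.re z.im : ℂ) - (u z.re z.im : ℂ) * Complex.I) z := by
  have key : ∀ {f : ℝ → ℝ → ℝ}, Differentiable ℝ (fun q : ℝ × ℝ => f q.1 q.2) →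
      HasFDerivAt (fun z : ℂ => (f z.re z.im : ℂ))
        (Complex.ofRealCLM.comp ((fderiv ℝ (fun q : ℝ × ℝ => f q.1 q.2) (z.re, z.im)).comp
          (Complex.equivRealProdCLM : ℂ →L[ℝ] ℝ × ℝ))) z := fun hf =>
    Complex.ofRealCLM.hasFDerivAt.comp z
      ((hf (z.re, z.im)).hasFDerivAt.comp (f := fun z : ℂ => (z.re, z.im)) z
        Complex.equivRealProdCLM.hasFDerivAt)
  have hF : HasFDerivAt
      (fun z : ℂ => -(v z.re z.im : ℂ) - (u z.re z.im : ℂ) * Complex.I) _ z :=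
    (key hv).neg.sub ((key hu).mul_const Complex.I)
  refine differentiableAt_complex_iff_differentiableAt_real.2 ⟨hF.differentiableAt, ?_⟩
  rw [hF.fderiv]
  have e1 : pdx u z.re z.im = -pdy v z.re z.im := by linarith
  have e2 : pdy u z.re z.im = pdx v z.re z.im := by linarith
  apply Complex.ext <;> simp [fderiv_apply_eq_pdx_pdy, hu, hv, e1, e2]

/-- The maximum principle for `Re G - v`, where `G` is entire and `u - i v` is holomorphic. -/
theorem re_sub_le_of_forall_boundary {u v : ℝ → ℝ → ℝ}
    (hu : Differentiable ℝ fun q : ℝ × ℝ => u q.1 q.2)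
    (hv : Differentiable ℝ fun q : ℝ × ℝ => v q.1 q.2)
    {G : ℂ → ℂ} (hG : Differentiable ℂ G) {U K : Set ℂ} (hUo : IsOpen U)
    (hUb : Bornology.IsBounded U) (hK : IsClosed K) (hUK : U ⊆ K)
    (hinc : ∀ z ∈ U, pdx u z.re z.im + pdy v z.re z.im = 0)
    (hirr : ∀ z ∈ U, pdy u z.re z.im - pdx v z.re z.im = 0) {M : ℝ}
    (hM : ∀ z ∈ K, z ∉ U → (G z).re - v z.re z.im ≤ M) {z : ℂ} (hz : z ∈ U) :
    (G z).re - v z.re z.im ≤ M := by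
  set F : ℂ → ℂ := fun z =>
    Complex.exp (G z + (-(v z.re z.im : ℂ) - (u z.re z.im : ℂ) * Complex.I)) with hF
  have hnorm : ∀ z, ‖F z‖ = Real.exp ((G z).re - v z.re z.im) := fun z => by
    simp [hF, Complex.norm_exp, sub_eq_add_neg]
  have hcont : Continuous F := by
    have h1 : Continuous fun z : ℂ => u z.re z.im :=
      hu.continuous.comp (f := fun z : ℂ => (z.re, z.im)) (by fun_prop)
    have h2 : Continuous fun z : ℂ => v z.re z.im :=
      hv.continuous.comp (f := fun z : ℂ => (z.re, z.im)) (by fun_prop)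
    have h3 := hG.continuous
    exact Complex.continuous_exp.comp (h3.add ((Complex.continuous_ofReal.comp h2).neg.sub
      ((Complex.continuous_ofReal.comp h1).mul continuous_const)))
  have hdiff : DiffContOnCl ℂ F U :=
    ⟨fun w hw => ((hG w).add
      (differentiableAt_complex_velocity hu hv (hinc w hw) (hirr w hw))).cexp.differentiableWithinAt,
      hcont.continuousOn⟩
  have := Complex.norm_le_of_forall_mem_frontier_norm_le hUb hdiff (C := Real.exp M)
    (fun w hw => by
      rw [hnorm, Real.exp_le_exp]
      rw [hUo.frontier_eq] at hw
      exact hM w (closure_minimal hUK hK hw.1) hw.2) (subset_closure hz)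
  rwa [hnorm, Real.exp_le_exp] at this

theorem isBounded_of_subset_re_im {U : Set ℂ} {a b c d : ℝ}
    (h : ∀ z ∈ U, (a ≤ z.re ∧ z.re ≤ b) ∧ c ≤ z.im ∧ z.im ≤ d) : Bornology.IsBounded U :=
  ((Metric.isBounded_Icc a b).reProdIm (Metric.isBounded_Icc c d)).subset fun z hz => h z hz

/-- A Hopf lemma on a rectangle, by comparison with a multiple of `sinh (k x) sin (k (y - y₁))`. -/
theorem pdx_pos_of_rectangle {u v : ℝ → ℝ → ℝ}
    (hu : Differentiable ℝ fun q : ℝ × ℝ => u q.1 q.2)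
    (hv : Differentiable ℝ fun q : ℝ × ℝ => v q.1 q.2)
    {a y₁ y₂ : ℝ} (ha : 0 < a) (hy : y₁ < y₂)
    (hinc : ∀ x ∈ Ioo 0 a, ∀ y ∈ Ioo y₁ y₂, pdx u x y + pdy v x y = 0)
    (hirr : ∀ x ∈ Ioo 0 a, ∀ y ∈ Ioo y₁ y₂, pdy u x y - pdx v x y = 0)
    (hv0 : ∀ y, v 0 y = 0)
    (hnn : ∀ x ∈ Ioc 0 a, ∀ y ∈ Icc y₁ y₂, 0 ≤ v x y)
    (hpos : ∀ y ∈ Icc y₁ y₂, 0 < v a y) :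
    0 < pdx v 0 ((y₁ + y₂) / 2) := by
  have hva : Continuous fun y => v a y :=
    hv.continuous.comp (f := fun y : ℝ => (a, y)) (by fun_prop)
  obtain ⟨ym, hym, hmin⟩ := isCompact_Icc.exists_isMinOn (nonempty_Icc.2 hy.le) hva.continuousOn
  have hm := hpos ym hym
  set m := v a ym
  set k := π / (y₂ - y₁) with hk
  have hyy : 0 < y₂ - y₁ := sub_pos.2 hy
  have hk0 : 0 < k := div_pos pi_pos hyy
  have hky : k * (y₂ - y₁) = π := by rw [hk]; field_simp
  have hsh : 0 < Real.sinh (k * a) := Real.sinh_pos_iff.2 (by positivity)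
  set ε := m / Real.sinh (k * a) with hε
  have hε0 : 0 < ε := div_pos hm hsh
  have hεm : ε * Real.sinh (k * a) = m := by rw [hε]; field_simp
  set G : ℂ → ℂ := fun z =>
    -Complex.I * (ε * Complex.cosh (k * (z - y₁ * Complex.I))) with hG
  have hGre : ∀ z, (G z).re = ε * (Real.sinh (k * z.re) * Real.sin (k * (z.im - y₁))) := by
    intro z
    have : (k : ℂ) * (z - y₁ * Complex.I) =
        ((k * z.re : ℝ) : ℂ) + ((k * (z.im - y₁) : ℝ) : ℂ) * Complex.I := by
      apply Complex.ext <;> simp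
    simp only [hG]
    rw [this, Complex.cosh_add, Complex.cosh_mul_I, Complex.sinh_mul_I, ← Complex.ofReal_cosh,
      ← Complex.ofReal_sinh, ← Complex.ofReal_cos, ← Complex.ofReal_sin]
    simp only [Complex.mul_re, Complex.mul_im, Complex.add_re, Complex.add_im, Complex.neg_re,
      Complex.neg_im, Complex.ofReal_re, Complex.ofReal_im, Complex.I_re, Complex.I_im]
    ring
  have hGd : Differentiable ℂ G := by
    intro z
    simp only [hG]
    fun_prop
  set y₀ := (y₁ + y₂) / 2 with hy₀
  have hsin : Real.sin (k * (y₀ - y₁)) = 1 := by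
    have : k * (y₀ - y₁) = π / 2 := by rw [← hky, hy₀]; ring
    rw [this, Real.sin_pi_div_two]
  have hlow : ∀ x ∈ Ioo 0 a, ε * k * x ≤ v x y₀ := by
    intro x hx
    have := re_sub_le_of_forall_boundary hu hv hGd (U := Ioo 0 a ×ℂ Ioo y₁ y₂)
      (K := Icc 0 a ×ℂ Icc y₁ y₂) (isOpen_Ioo.reProdIm isOpen_Ioo)
      ((Metric.isBounded_Ioo _ _).reProdIm (Metric.isBounded_Ioo _ _))
      (isClosed_Icc.reProdIm isClosed_Icc)
      (fun z hz => ⟨Ioo_subset_Icc_self hz.1, Ioo_subset_Icc_self hz.2⟩)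
      (fun z hz => hinc _ hz.1 _ hz.2) (fun z hz => hirr _ hz.1 _ hz.2) (M := 0)
      (z := ⟨x, y₀⟩) ?_ ⟨hx, ⟨by simp [hy₀]; linarith, by simp [hy₀]; linarith⟩⟩
    · rw [hGre] at this
      simp only [hsin, mul_one] at this
      have h2 : k * x ≤ Real.sinh (k * x) :=
        Real.self_le_sinh_iff.2 (mul_nonneg hk0.le hx.1.le)
      nlinarith
    · rintro ⟨s, t⟩ ⟨⟨hs0, hsa⟩, ht1, ht2⟩ hnot
      rw [hGre]
      simp only at hs0 hsa ht1 ht2 ⊢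
      rcases hs0.eq_or_lt with h | hs0
      · subst h
        simp [hv0]
      have hst := hnn s ⟨hs0, hsa⟩ t ⟨ht1, ht2⟩
      rcases ht1.eq_or_lt with h | ht1'
      · subst h
        simpa using hst
      rcases ht2.eq_or_lt with h | ht2'
      · subst h
        simpa [hky] using hst
      rcases hsa.eq_or_lt with h | hsa
      · subst h
        have h1 : m ≤ v s t := hmin (show t ∈ Icc y₁ y₂ from ⟨ht1, ht2⟩)
        have h2 := mul_le_mul_of_nonneg_left (Real.sin_le_one (k * (t - y₁))) hm.le
        rw [← mul_assoc, hεm]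
        linarith
      · exact absurd ⟨⟨hs0, hsa⟩, ht1', ht2'⟩ hnot
  have hslope := ((hasDerivAt_pdx hv 0 y₀).tendsto_slope).mono_left
    (nhdsWithin_mono 0 (fun x (hx : x ∈ Ioi (0 : ℝ)) => ne_of_gt hx))
  refine lt_of_lt_of_le (mul_pos hε0 hk0) (ge_of_tendsto hslope ?_)
  filter_upwards [Ioo_mem_nhdsGT ha] with x hx
  rw [slope_def_field, hv0, sub_zero, sub_zero, le_div_iff₀ hx.1]
  exact hlow x hx

/-- In the right half of a fluid layer below the graph of `η`, a vertical velocity that is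
nonnegative on the boundary and vanishes at infinity is nonnegative. -/
theorem nonneg_of_boundary_nonneg {u v : ℝ → ℝ → ℝ} {η : ℝ → ℝ} {b B : ℝ}
    (hu : Differentiable ℝ fun q : ℝ × ℝ => u q.1 q.2)
    (hv : Differentiable ℝ fun q : ℝ × ℝ => v q.1 q.2)
    (hη : Continuous η) (hB : ∀ x, 0 ≤ x → η x ≤ B)
    (hinc : ∀ x y, 0 < x → b < y → y < η x → pdx u x y + pdy v x y = 0)
    (hirr : ∀ x y, 0 < x → b < y → y < η x → pdy u x y - pdx v x y = 0)
    (hv0 : ∀ y, v 0 y = 0) (hbed : ∀ x, v x b = 0) (hsurf : ∀ x, 0 < x → 0 ≤ v x (η x))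
    (hlim : ∀ ε > 0, ∃ R > 0, ∀ x y, b ≤ y → y ≤ η x → R < |x| → |v x y| < ε)
    {x y : ℝ} (hx : 0 < x) (hy : b < y) (hyη : y < η x) : 0 ≤ v x y := by
  refine le_of_forall_pos_le_add fun ε hε => ?_
  obtain ⟨R, hR, hfar⟩ := hlim ε hε
  set R' := max R x + 1 with hR'
  have hRR : R < R' := (le_max_left R x).trans_lt (lt_add_one _)
  have hxR : x < R' := (le_max_right R x).trans_lt (lt_add_one _)
  have := re_sub_le_of_forall_boundary hu hv (G := fun _ => 0) (differentiable_const _)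
    (U := {z : ℂ | (0 < z.re ∧ z.re < R') ∧ b < z.im ∧ z.im < η z.re})
    (K := {z : ℂ | (0 ≤ z.re ∧ z.re ≤ R') ∧ b ≤ z.im ∧ z.im ≤ η z.re}) ?_
    (isBounded_of_subset_re_im fun z hz =>
      ⟨⟨hz.1.1.le, hz.1.2.le⟩, hz.2.1.le, hz.2.2.le.trans (hB _ hz.1.1.le)⟩) ?_
    (fun z hz => ⟨⟨hz.1.1.le, hz.1.2.le⟩, hz.2.1.le, hz.2.2.le⟩)
    (fun z hz => hinc _ _ hz.1.1 hz.2.1 hz.2.2) (fun z hz => hirr _ _ hz.1.1 hz.2.1 hz.2.2)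
    (M := ε) (z := ⟨x, y⟩) ?_ ⟨⟨hx, hxR⟩, hy, hyη⟩
  · simp at this
    linarith
  · refine IsOpen.and (IsOpen.and ?_ ?_) (IsOpen.and ?_ ?_) <;>
      exact isOpen_lt (by fun_prop) (by fun_prop)
  · refine IsClosed.and (IsClosed.and ?_ ?_) (IsClosed.and ?_ ?_) <;>
      exact isClosed_le (by fun_prop) (by fun_prop)
  · rintro ⟨s, t⟩ ⟨⟨hs0, hsR⟩, htb, htη⟩ hnot
    simp only at hs0 hsR htb htη
    suffices h : -ε ≤ v s t by simp; linarith
    rcases hs0.eq_or_lt with h | hs0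
    · subst h
      linarith [hv0 t]
    rcases hsR.eq_or_lt with h | hsR
    · have := hfar s t htb htη (by rw [abs_of_pos hs0, h]; exact hRR)
      exact (abs_lt.1 this).1.le
    rcases htb.eq_or_lt with h | htb
    · subst h
      linarith [hbed s]
    rcases htη.eq_or_lt with h | htη
    · subst h
      linarith [hsurf s hs0]
    · exact absurd ⟨⟨hs0, hsR⟩, htb, htη⟩ hnot

/-- Bernoulli's law: the total head is the same at all points of the fluid. -/
theorem bernoulli_law {u v P : ℝ → ℝ → ℝ} {η : ℝ → ℝ} {b c g : ℝ}
    (hu : Differentiable ℝ fun q : ℝ × ℝ => u q.1 q.2)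
    (hv : Differentiable ℝ fun q : ℝ × ℝ => v q.1 q.2)
    (hP : Differentiable ℝ fun q : ℝ × ℝ => P q.1 q.2) (hb : ∀ x, b < η x)
    (hirr : ∀ x y, b ≤ y → y ≤ η x → pdy u x y - pdx v x y = 0)
    (heuler1 : ∀ x y, b ≤ y → y ≤ η x →
      (u x y - c) * pdx u x y + v x y * pdy u x y = -pdx P x y)
    (heuler2 : ∀ x y, b ≤ y → y ≤ η x →
      (u x y - c) * pdx v x y + v x y * pdy v x y = -pdy P x y - g) :
    ∃ E, ∀ x y, b ≤ y → y ≤ η x →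
      (u x y - c) ^ 2 / 2 + v x y ^ 2 / 2 + P x y + g * y = E := by
  have hdx : ∀ x, HasDerivAt
      (fun x => (u x b - c) ^ 2 / 2 + v x b ^ 2 / 2 + P x b + g * b) 0 x := fun x => by
    have h := (((((hasDerivAt_pdx hu x b).sub_const c).pow 2).div_const 2).add
      (((hasDerivAt_pdx hv x b).pow 2).div_const 2)).add (hasDerivAt_pdx hP x b) |>.add_const (g * b)
    refine h.congr_deriv ?_
    have h1 := hirr x b le_rfl (hb x).le
    have h2 := heuler1 x b le_rfl (hb x).le
    simp
    linear_combination h2 - v x b * h1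
  have hdy : ∀ x y, b ≤ y → y ≤ η x → HasDerivAt
      (fun y => (u x y - c) ^ 2 / 2 + v x y ^ 2 / 2 + P x y + g * y) 0 y := fun x y hy hyη => by
    have h := ((((((hasDerivAt_pdy hu x y).sub_const c).pow 2).div_const 2).add
      (((hasDerivAt_pdy hv x y).pow 2).div_const 2)).add (hasDerivAt_pdy hP x y)).add
      ((hasDerivAt_id y).const_mul g)
    refine h.congr_deriv ?_
    have h1 := hirr x y hy hyη
    have h2 := heuler2 x y hy hyη
    simp
    linear_combination h2 + (u x y - c) * h1
  refine ⟨(u 0 b - c) ^ 2 / 2 + v 0 b ^ 2 / 2 + P 0 b + g * b, fun x y hy hyη => ?_⟩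
  rw [constant_of_has_deriv_right_zero
    (fun t ht => (hdy x t ht.1 ht.2).continuousAt.continuousWithinAt)
    (fun t ht => (hdy x t ht.1 ht.2.le).hasDerivWithinAt) y ⟨hy, hyη⟩]
  exact is_const_of_deriv_eq_zero (fun x => (hdx x).differentiableAt) (fun x => (hdx x).deriv) x 0

/-- The fluid flows strictly faster at the crest than at the bed beneath it. -/
theorem bed_velocity_lt_crest_velocity {u v : ℝ → ℝ → ℝ} {η : ℝ → ℝ} {b c : ℝ}
    (hu : Differentiable ℝ fun q : ℝ × ℝ => u q.1 q.2)
    (hv : Differentiable ℝ fun q : ℝ × ℝ => v q.1 q.2)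
    (hη : Differentiable ℝ η) (hb : ∀ x, b < η x) (hdec : StrictAntiOn η (Ioi 0))
    (hinc : ∀ x y, b ≤ y → y ≤ η x → pdx u x y + pdy v x y = 0)
    (hirr : ∀ x y, b ≤ y → y ≤ η x → pdy u x y - pdx v x y = 0)
    (hsurfv : ∀ x, v x (η x) = (u x (η x) - c) * deriv η x)
    (hv0 : ∀ y, v 0 y = 0) (hbed : ∀ x, v x b = 0)
    (huc : ∀ x y, b ≤ y → y ≤ η x → u x y < c)
    (hlim : ∀ ε > 0, ∃ R > 0, ∀ x y, b ≤ y → y ≤ η x → R < |x| → |v x y| < ε) :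
    u 0 b < u 0 (η 0) := by
  have hcrest : ∀ x, 0 < x → η x ≤ η 0 := fun x hx => by
    have ht : Tendsto η (nhdsWithin 0 (Ioi 0)) (nhds (η 0)) :=
      hη.continuous.continuousAt.tendsto.mono_left nhdsWithin_le_nhds
    refine ge_of_tendsto ht ?_
    filter_upwards [Ioo_mem_nhdsGT hx] with t ht'
    exact (hdec ht'.1 hx ht'.2).le
  have hderiv : ∀ x, 0 < x → deriv η x ≤ 0 := fun x hx => by
    rw [← derivWithin_of_mem_nhds (Ioi_mem_nhds hx)]
    exact hdec.antitoneOn.derivWithin_nonpos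
  have hnn : ∀ x y, 0 < x → b < y → y < η x → 0 ≤ v x y := fun x y hx hy hyη => by
    refine nonneg_of_boundary_nonneg hu hv hη.continuous (B := η 0) ?_
      (fun x y _ h1 h2 => hinc x y h1.le h2.le) (fun x y _ h1 h2 => hirr x y h1.le h2.le)
      hv0 hbed ?_ hlim hx hy hyη
    · intro x hx
      rcases hx.eq_or_lt with h | h
      · rw [← h]
      · exact hcrest x h
    · intro x hx
      rw [hsurfv]
      exact mul_nonneg_of_nonpos_of_nonpos
        (sub_nonpos.2 (huc x _ (hb x).le le_rfl).le) (hderiv x hx)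
  have hvy : ∀ x, Continuous fun y => v x y := fun x =>
    hv.continuous.comp (f := fun y : ℝ => (x, y)) (by fun_prop)
  obtain ⟨a, ya, ha, hya, hyaη, hva⟩ : ∃ a y, 0 < a ∧ b < y ∧ y < η a ∧ 0 < v a y := by
    by_contra! hcon
    have hzero : ∀ x, 0 < x → deriv η x = 0 := fun x hx => by
      have hs : v x (η x) ≤ 0 := by
        have ht : Tendsto (fun y => v x y) (nhdsWithin (η x) (Iio (η x))) (nhds (v x (η x))) :=
          (hvy x).continuousAt.tendsto.mono_left nhdsWithin_le_nhds
        refine le_of_tendsto ht ?_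
        filter_upwards [Ioo_mem_nhdsLT (hb x)] with t ht'
        exact hcon x t hx ht'.1 ht'.2
      rw [hsurfv] at hs
      refine le_antisymm (hderiv x hx) ?_
      have := huc x _ (hb x).le le_rfl
      nlinarith
    have h12 := constant_of_has_deriv_right_zero (f := η) (a := 1) (b := 2)
      hη.continuous.continuousOn (fun t ht => by
        have := (hη t).hasDerivAt.hasDerivWithinAt (s := Ici t)
        rwa [hzero t (by linarith [ht.1])] at this) 2 (by norm_num)
    exact (hdec (show (1 : ℝ) ∈ Ioi 0 by norm_num) (show (2 : ℝ) ∈ Ioi 0 by norm_num)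
      (by norm_num)).ne h12
  obtain ⟨δ, hδ, hball⟩ : ∃ δ > 0, ∀ y ∈ Icc (ya - δ) (ya + δ), b < y ∧ y < η a ∧ 0 < v a y := by
    have : ∀ᶠ y in nhds ya, b < y ∧ y < η a ∧ 0 < v a y :=
      (lt_mem_nhds hya).and ((gt_mem_nhds hyaη).and
        ((hvy a).continuousAt.eventually (lt_mem_nhds hva)))
    obtain ⟨δ, hδ, h⟩ := Metric.nhds_basis_closedBall.eventually_iff.1 this
    exact ⟨δ, hδ, fun y hy => h (by rwa [Real.closedBall_eq_Icc])⟩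
  have hin : ∀ x ∈ Ioc 0 a, ∀ y ∈ Icc (ya - δ) (ya + δ), b < y ∧ y < η x := fun x hx y hy =>
    ⟨(hball y hy).1, (hball y hy).2.1.trans_le (hdec.antitoneOn hx.1 ha hx.2)⟩
  have hhopf : 0 < pdx v 0 ya := by
    have := pdx_pos_of_rectangle hu hv ha (y₁ := ya - δ) (y₂ := ya + δ) (by linarith)
      (fun x hx y hy => by
        have := hin x (Ioo_subset_Ioc_self hx) y (Ioo_subset_Icc_self hy)
        exact hinc x y this.1.le this.2.le)
      (fun x hx y hy => by
        have := hin x (Ioo_subset_Ioc_self hx) y (Ioo_subset_Icc_self hy)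
        exact hirr x y this.1.le this.2.le)
      hv0 (fun x hx y hy => hnn x y hx.1 (hin x hx y hy).1 (hin x hx y hy).2)
      (fun y hy => (hball y hy).2.2)
    rwa [show (ya - δ + (ya + δ)) / 2 = ya by ring] at this
  have hya0 : ya < η 0 := hyaη.trans_le (hcrest a ha)
  have hdu : ∀ y, b ≤ y → y ≤ η 0 → HasDerivAt (fun y => u 0 y) (pdx v 0 y) y := fun y h1 h2 =>
    (hasDerivAt_pdy hu 0 y).congr_deriv (sub_eq_zero.1 (hirr 0 y h1 h2))
  have hvx : ∀ y, b < y → y < η 0 → 0 ≤ pdx v 0 y := fun y h1 h2 => by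
    have hslope := ((hasDerivAt_pdx hv 0 y).tendsto_slope).mono_left
      (nhdsWithin_mono 0 (fun x (hx : x ∈ Ioi (0 : ℝ)) => ne_of_gt hx))
    refine ge_of_tendsto hslope ?_
    filter_upwards [self_mem_nhdsWithin, mem_nhdsWithin_of_mem_nhds
      (hη.continuous.continuousAt.eventually (lt_mem_nhds h2))] with x hx hyx
    rw [slope_def_field, hv0, sub_zero, sub_zero]
    exact div_nonneg (hnn x y hx h1 hyx) (le_of_lt hx)
  have hmono : MonotoneOn (fun y => u 0 y) (Icc b (η 0)) :=
    monotoneOn_of_deriv_nonneg (convex_Icc _ _)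
      (fun y hy => (hdu y hy.1 hy.2).continuousAt.continuousWithinAt)
      (fun y hy => by
        rw [interior_Icc] at hy
        exact (hdu y hy.1.le hy.2.le).differentiableAt.differentiableWithinAt)
      (fun y hy => by
        rw [interior_Icc] at hy
        rw [(hdu y hy.1.le hy.2.le).deriv]
        exact hvx y hy.1 hy.2)
  have hbm : b ∈ Icc b (η 0) := left_mem_Icc.2 (hb 0).le
  have hηm : η 0 ∈ Icc b (η 0) := right_mem_Icc.2 (hb 0).le
  refine (hmono hbm hηm (hb 0).le).lt_of_ne fun heq => hhopf.ne ?_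
  simp only at heq
  have hloc : (fun y => u 0 y) =ᶠ[nhds ya] fun _ => u 0 b := by
    filter_upwards [Ioo_mem_nhds hya hya0] with y hy
    have hy' := Ioo_subset_Icc_self hy
    exact le_antisymm ((hmono hy' hηm hy'.2).trans_eq heq.symm) (hmono hbm hy' hy'.1)
  exact ((hasDerivAt_const ya (u 0 b)).congr_of_eventuallyEq hloc).unique
    (hdu ya hya.le hya0.le)

/-- The pressure at the bed beneath the crest gives a lower bound on the wave height:
`P(x,-d) → P_∞ = P_atm + g·d` as `x → ∞`, and the maximum surface elevation
`h = η 0` satisfies `h > (P(0,-d) - P_∞)/g`. -/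
theorem wave_height_lower_bound
    (d g c P_atm : ℝ) (hd : 0 < d) (hg : 0 < g) (hc : Real.sqrt (g * d) < c)
    (η : ℝ → ℝ) (hη : ContDiff ℝ (⊤ : ℕ∞) η)
    (hηd : ∀ x, -d < η x) (hηeven : ∀ x, η (-x) = η x)
    (hηdec : StrictAntiOn η (Set.Ioi 0))
    (hηlim : Filter.Tendsto η (Filter.cocompact ℝ) (nhds 0))
    (Ω : Set (ℝ × ℝ)) (hΩ : Ω = {q : ℝ × ℝ | -d < q.2 ∧ q.2 < η q.1})
    (u v P : ℝ → ℝ → ℝ)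
    (hu : ContDiff ℝ (⊤ : ℕ∞) (fun q : ℝ × ℝ => u q.1 q.2))
    (hv : ContDiff ℝ (⊤ : ℕ∞) (fun q : ℝ × ℝ => v q.1 q.2))
    (hP : ContDiff ℝ (⊤ : ℕ∞) (fun q : ℝ × ℝ => P q.1 q.2))
    (hinc : ∀ x y, (x, y) ∈ closure Ω → pdx u x y + pdy v x y = 0)
    (hirr : ∀ x y, (x, y) ∈ closure Ω → pdy u x y - pdx v x y = 0)
    (heuler1 : ∀ x y, (x, y) ∈ closure Ω →
      (u x y - c) * pdx u x y + v x y * pdy u x y = -pdx P x y)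
    (heuler2 : ∀ x y, (x, y) ∈ closure Ω →
      (u x y - c) * pdx v x y + v x y * pdy v x y = -pdy P x y - g)
    (hsurfP : ∀ x, P x (η x) = P_atm)
    (hsurfv : ∀ x, v x (η x) = (u x (η x) - c) * deriv η x)
    (hbed : ∀ x, v x (-d) = 0)
    (husym : ∀ x y, u (-x) y = u x y)
    (hvsym : ∀ x y, v (-x) y = -v x y)
    (huc : ∀ x y, (x, y) ∈ closure Ω → u x y < c)
    (hulim : ∀ ε > 0, ∃ R > 0, ∀ x y, (x, y) ∈ closure Ω → R < |x| → |u x y| < ε)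
    (hvlim : ∀ ε > 0, ∃ R > 0, ∀ x y, (x, y) ∈ closure Ω → R < |x| → |v x y| < ε)
    (p : ℝ → ℝ → ℝ) (hp : ∀ x y, p x y = P x y - (P_atm - g * y)) :
    Filter.Tendsto (fun x => P x (-d)) Filter.atTop (nhds (P_atm + g * d)) ∧
    (P 0 (-d) - (P_atm + g * d)) / g < η 0 := by
  have hcl : ∀ x y, -d ≤ y → y ≤ η x → (x, y) ∈ closure Ω := fun x y h1 h2 => by
    have hy : y ∈ closure (Ioo (-d) (η x)) := by
      rw [closure_Ioo (hηd x).ne]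
      exact ⟨h1, h2⟩
    refine map_mem_closure (f := fun t : ℝ => (x, t)) (by fun_prop) hy fun t ht => ?_
    rw [hΩ]
    exact ht
  have top_ne : ((⊤ : ℕ∞) : WithTop ℕ∞) ≠ 0 := by simp
  have hu' := hu.differentiable top_ne
  have hv' := hv.differentiable top_ne
  have hv0 : ∀ y, v 0 y = 0 := fun y => by
    have := hvsym 0 y
    rw [neg_zero] at this
    linarith
  obtain ⟨E, hE⟩ := bernoulli_law hu' hv' (hP.differentiable top_ne) hηd
    (fun x y h1 h2 => hirr x y (hcl x y h1 h2)) (fun x y h1 h2 => heuler1 x y (hcl x y h1 h2))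
    (fun x y h1 h2 => heuler2 x y (hcl x y h1 h2))
  have tendsto_zero : ∀ w : ℝ → ℝ → ℝ,
      (∀ ε > 0, ∃ R > 0, ∀ x y, (x, y) ∈ closure Ω → R < |x| → |w x y| < ε) →
      ∀ f : ℝ → ℝ, (∀ x, -d ≤ f x ∧ f x ≤ η x) → Tendsto (fun x => w x (f x)) atTop (nhds 0) := by
    intro w hw f hf
    refine Metric.tendsto_atTop.2 fun ε hε => ?_
    obtain ⟨R, hR, h⟩ := hw ε hε
    refine ⟨R + 1, fun x hx => ?_⟩
    rw [dist_zero_right]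
    exact h x _ (hcl x _ (hf x).1 (hf x).2) (by rw [abs_of_pos] <;> linarith)
  have hsurf : ∀ x, -d ≤ η x ∧ η x ≤ η x := fun x => ⟨(hηd x).le, le_rfl⟩
  have hbot : ∀ x, -d ≤ -d ∧ -d ≤ η x := fun x => ⟨le_rfl, (hηd x).le⟩
  have hEval : c ^ 2 / 2 + P_atm = E := by
    have h1 := tendsto_zero u hulim η hsurf
    have h2 := tendsto_zero v hvlim η hsurf
    have h3 : Tendsto η atTop (nhds 0) := hηlim.mono_left atTop_le_cocompact
    have h4 := (((((h1.sub_const c).pow 2).div_const 2).add ((h2.pow 2).div_const 2)).add_const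
      P_atm).add (h3.const_mul g)
    have h5 : Tendsto (fun _ : ℝ => E) atTop
        (nhds ((0 - c) ^ 2 / 2 + 0 ^ 2 / 2 + P_atm + g * 0)) :=
      h4.congr fun x => by rw [← hE x (η x) (hηd x).le le_rfl, hsurfP]
    have := tendsto_nhds_unique h5 tendsto_const_nhds
    linarith
  constructor
  · have h1 := tendsto_zero u hulim (fun _ => -d) hbot
    have h2 := ((h1.sub_const c).pow 2).div_const 2 |>.const_sub (E + g * d)
    have h3 : E + g * d - (0 - c) ^ 2 / 2 = P_atm + g * d := by rw [← hEval]; ring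
    rw [h3] at h2
    refine h2.congr fun x => ?_
    rw [← hE x (-d) le_rfl (hηd x).le, hbed]
    ring
  · have hlt := bed_velocity_lt_crest_velocity (c := c) hu' hv' (hη.differentiable top_ne) hηd hηdec
      (fun x y h1 h2 => hinc x y (hcl x y h1 h2)) (fun x y h1 h2 => hirr x y (hcl x y h1 h2))
      hsurfv hv0 hbed (fun x y h1 h2 => huc x y (hcl x y h1 h2))
      (fun ε hε => (hvlim ε hε).imp fun R hR =>
        ⟨hR.1, fun x y h1 h2 => hR.2 x y (hcl x y h1 h2)⟩)
    have hcr := huc 0 (η 0) (hcl 0 _ (hηd 0).le le_rfl)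
    have hb := hE 0 (-d) le_rfl (hηd 0).le
    have ht := hE 0 (η 0) (hηd 0).le le_rfl
    rw [hv0] at hb ht
    rw [hsurfP] at ht
    rw [div_lt_iff₀ hg]
    nlinarith
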